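/- Let F = F̆(α_1,…,α_t) be a fence and let i ∈ {1,…,t} and j, k ∈ {1,…,β_i}. (1) If the segment S_i has no valley, then k·χ̂_{(i,j)} − j·χ̂_{(i,k)} ≡ k − j, i.e. k·χ̂_{(i,j)} − j·χ̂_{(i,k)} − (k − j) lies in the ℝ-span of the toggleability statistics {T_p : p ∈ F}. (2) If the segment S_i has no peak, then (α_i − k)·χ̂_{(i,j)} − (α_i − j)·χ̂_{(i,k)} ≡ 0, i.e. this statistic lies in the ℝ-span of {T_p : p ∈ F}. -/

import Mathlib

open scoped Classical

namespace Fence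

/-- partial sums: `m α i = α 0 + ⋯ + α (i-1)` (the paper's `m_i`). -/
def m (α : ℕ → ℕ) (i : ℕ) : ℕ := ∑ k ∈ Finset.range i, α k

/-- the number `n` of elements of the fence `F̆(α)`. -/
def nn (t : ℕ) (α : ℕ → ℕ) : ℕ := m α t - 1

/-- vertex type: index `0` is a dummy (used as sentinel for nonexistent elements);
the fence elements are the indices `1,…,nn t α`. -/
abbrev V (t : ℕ) (α : ℕ → ℕ) := Fin (nn t α + 1)

/-- the element `x_j` (1-based). -/
def xel (t : ℕ) (α : ℕ → ℕ) (j : ℕ) : V t α :=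
  ⟨j % (nn t α + 1), Nat.mod_lt _ (Nat.succ_pos _)⟩

/-- `p` is an actual element of the fence (not the dummy `0`). -/
def Elem (t : ℕ) (α : ℕ → ℕ) (p : V t α) : Prop := 1 ≤ (p : ℕ)

/-- the conditions on `(t, α)` for `F̆(α)` to be a fence. -/
def IsFence (t : ℕ) (α : ℕ → ℕ) : Prop :=
  2 ≤ t ∧ (∀ i < t, 1 ≤ α i) ∧ 2 ≤ α 0 ∧ 2 ≤ α (t - 1)

/-- the covering relation of the fence: `Cov t α a b` means `a ⋖ b`. -/
def Cov (t : ℕ) (α : ℕ → ℕ) (a b : V t α) : Prop :=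
  ∃ i < t, ((i % 2 = 0 ∧ (b : ℕ) = (a : ℕ) + 1) ∨ (i % 2 = 1 ∧ (a : ℕ) = (b : ℕ) + 1)) ∧
    m α i ≤ min (a : ℕ) (b : ℕ) ∧ min (a : ℕ) (b : ℕ) < m α (i + 1) ∧
    1 ≤ min (a : ℕ) (b : ℕ) ∧ max (a : ℕ) (b : ℕ) ≤ nn t α

/-- the order of the fence: reflexive–transitive closure of the covering relation. -/
def Le (t : ℕ) (α : ℕ → ℕ) : V t α → V t α → Prop := Relation.ReflTransGen (Cov t α)

/-- order ideals of the fence (as sets of actual elements, downward closed). -/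
def IsIdeal (t : ℕ) (α : ℕ → ℕ) (I : Set (V t α)) : Prop :=
  (∀ p ∈ I, Elem t α p) ∧ ∀ a b : V t α, Le t α a b → b ∈ I → a ∈ I

/-- `J t α` is the set of order ideals of the fence. -/
abbrev J (t : ℕ) (α : ℕ → ℕ) := {I : Set (V t α) // IsIdeal t α I}

/-- `p` is a maximal element of the set `I`. -/
def MaxIn (t : ℕ) (α : ℕ → ℕ) (I : Set (V t α)) (p : V t α) : Prop :=
  p ∈ I ∧ ∀ q ∈ I, Le t α p q → q = p

/-- `p` is a minimal element of the complement of `I` (among actual elements). -/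
def MinOut (t : ℕ) (α : ℕ → ℕ) (I : Set (V t α)) (p : V t α) : Prop :=
  Elem t α p ∧ p ∉ I ∧ ∀ q : V t α, Elem t α q → q ∉ I → Le t α q p → q = p

/-- the order-ideal indicator function `χ̂_p`. -/
noncomputable def chiHat (t : ℕ) (α : ℕ → ℕ) (p : V t α) (I : J t α) : ℝ :=
  if p ∈ I.1 then 1 else 0

/-- the antichain indicator function `χ_p`. -/
noncomputable def chi (t : ℕ) (α : ℕ → ℕ) (p : V t α) (I : J t α) : ℝ :=
  if MaxIn t α I.1 p then 1 else 0

/-- the toggleability statistic `T_p`. -/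
noncomputable def Tg (t : ℕ) (α : ℕ → ℕ) (p : V t α) (I : J t α) : ℝ :=
  if MinOut t α I.1 p then 1 else if MaxIn t α I.1 p then -1 else 0

/-- the antichain toggleability statistic `T_A`. -/
noncomputable def TA (t : ℕ) (α : ℕ → ℕ) (A : Set (V t α)) (I : J t α) : ℝ :=
  if ∀ p ∈ A, MinOut t α I.1 p then 1 else if ∀ p ∈ A, MaxIn t α I.1 p then -1 else 0

/-- `#[a,b]`: the number of elements `r` with `a ⊴ r ⊴ b`. -/
noncomputable def icard (t : ℕ) (α : ℕ → ℕ) (a b : V t α) : ℕ :=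
  Set.ncard {r : V t α | Elem t α r ∧ Le t α a r ∧ Le t α r b}

/-- the span of the toggleability statistics `{T_p : p ∈ F}`. -/
noncomputable def ToggSpan (t : ℕ) (α : ℕ → ℕ) : Submodule ℝ (J t α → ℝ) :=
  Submodule.span ℝ {f | ∃ p : V t α, Elem t α p ∧ f = Tg t α p}

/-- `f ≡ g`: `f - g` is an `ℝ`-linear combination of toggleability statistics. -/
def Equiv' (t : ℕ) (α : ℕ → ℕ) (f g : J t α → ℝ) : Prop := f - g ∈ ToggSpan t α

/-- statistics of the form `const + linear combination of toggleability statistics`. -/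
noncomputable def ConstPlusTogg (t : ℕ) (α : ℕ → ℕ) : Submodule ℝ (J t α → ℝ) :=
  ToggSpan t α ⊔ Submodule.span ℝ {fun _ : J t α => (1 : ℝ)}

/-- the span of the antichain indicator functions `{χ_p : p ∈ F}`. -/
noncomputable def chiSpan (t : ℕ) (α : ℕ → ℕ) : Submodule ℝ (J t α → ℝ) :=
  Submodule.span ℝ {f | ∃ p : V t α, Elem t α p ∧ f = chi t α p}

/-- the span of the order-ideal indicator functions `{χ̂_p : p ∈ F}`. -/
noncomputable def chiHatSpan (t : ℕ) (α : ℕ → ℕ) : Submodule ℝ (J t α → ℝ) :=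
  Submodule.span ℝ {f | ∃ p : V t α, Elem t α p ∧ f = chiHat t α p}

/-- the antichain toggleability space `A_T(F)`. -/
noncomputable def AT (t : ℕ) (α : ℕ → ℕ) : Submodule ℝ (J t α → ℝ) :=
  chiSpan t α ⊓ ConstPlusTogg t α

/-- the order ideal toggleability space `I_T(F)`. -/
noncomputable def IT (t : ℕ) (α : ℕ → ℕ) : Submodule ℝ (J t α → ℝ) :=
  chiHatSpan t α ⊓ ConstPlusTogg t α

/-- the shared element `s_i = x_{m_i}` (for `1 ≤ i ≤ t-1`); the sentinels `i = 0` and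
`i = t` give the dummy vertex `0`, so statistics indexed by them vanish. -/
def sElx (t : ℕ) (α : ℕ → ℕ) (i : ℕ) : V t α := xel t α (m α i)

/-- 1-based index of the unshared element `s_{(i,j)}` (the `j`-th smallest unshared
element of the segment `S_i`, in the order of the fence). -/
def uEl (α : ℕ → ℕ) (i j : ℕ) : ℕ :=
  if (i - 1) % 2 = 0 then m α (i - 1) + j else m α i - j

def uElx (t : ℕ) (α : ℕ → ℕ) (i j : ℕ) : V t α := xel t α (uEl α i j)

/-- 1-based index of the peak of segment `S_i` (sentinel `0` if it does not exist). -/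
def peakN (t : ℕ) (α : ℕ → ℕ) (i : ℕ) : ℕ :=
  if i % 2 = 1 then (if i + 1 ≤ t then m α i else 0) else m α (i - 1)

/-- 1-based index of the valley of segment `S_i` (sentinel `0` if it does not exist). -/
def valleyN (t : ℕ) (α : ℕ → ℕ) (i : ℕ) : ℕ :=
  if i % 2 = 1 then (if 2 ≤ i then m α (i - 1) else 0) else (if i + 1 ≤ t then m α i else 0)

def peakx (t : ℕ) (α : ℕ → ℕ) (i : ℕ) : V t α := xel t α (peakN t α i)
def valleyx (t : ℕ) (α : ℕ → ℕ) (i : ℕ) : V t α := xel t α (valleyN t α i)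

/-- segment `S_i` has a peak. -/
def HasPeak (t i : ℕ) : Prop := i % 2 = 0 ∨ i + 1 ≤ t

/-- segment `S_i` has a valley. -/
def HasValley (t i : ℕ) : Prop := (i % 2 = 1 ∧ 2 ≤ i) ∨ (i % 2 = 0 ∧ i + 1 ≤ t)

/-- `p` is a shared element of the fence. -/
def IsSharedElem (t : ℕ) (α : ℕ → ℕ) (p : V t α) : Prop :=
  ∃ i, 1 ≤ i ∧ i + 1 ≤ t ∧ p = sElx t α i

/-- `p` is a peak of the fence. -/
def IsPeakElem (t : ℕ) (α : ℕ → ℕ) (p : V t α) : Prop :=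
  ∃ i, 1 ≤ i ∧ i + 1 ≤ t ∧ i % 2 = 1 ∧ p = sElx t α i

/-- span of the antichain indicators of the shared elements. -/
noncomputable def chiSharedSpan (t : ℕ) (α : ℕ → ℕ) : Submodule ℝ (J t α → ℝ) :=
  Submodule.span ℝ {f | ∃ i, 1 ≤ i ∧ i + 1 ≤ t ∧ f = chi t α (sElx t α i)}

/-- span of the order-ideal indicators of the shared elements. -/
noncomputable def chiHatSharedSpan (t : ℕ) (α : ℕ → ℕ) : Submodule ℝ (J t α → ℝ) :=
  Submodule.span ℝ {f | ∃ i, 1 ≤ i ∧ i + 1 ≤ t ∧ f = chiHat t α (sElx t α i)}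

theorem cov_elem {t : ℕ} {α : ℕ → ℕ} {a b : V t α} (h : Cov t α a b) :
    Elem t α a ∧ Elem t α b := by
  obtain ⟨i, hi, hd, h1, h2, h3, h4⟩ := h
  constructor <;> (simp only [Elem]; omega)

theorem le_elem {t : ℕ} {α : ℕ → ℕ} {a b : V t α} (h : Le t α a b) (hb : Elem t α b) :
    Elem t α a := by
  induction h using Relation.ReflTransGen.head_induction_on with
  | refl => exact hb
  | head hc _ _ => exact (cov_elem hc).1

/-- rowmotion: `ρ(I)` is the order ideal generated by the minimal elements of the
complement of `I`. -/
noncomputable def rho (t : ℕ) (α : ℕ → ℕ) (I : J t α) : J t α :=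
  ⟨{q | ∃ p : V t α, MinOut t α I.1 p ∧ Le t α q p}, by
    constructor
    · rintro q ⟨p, hp, hle⟩
      exact le_elem hle hp.1
    · rintro a b hab ⟨p, hp, hle⟩
      exact ⟨p, hp, Relation.ReflTransGen.trans hab hle⟩⟩

/-- the (forward) orbit of `x` under `ρ`. -/
def orbit {X : Type*} (ρ : X → X) (x : X) : Set X := {y | ∃ k : ℕ, ρ^[k] x = y}

/-- `f` is `c`-mesic under `ρ`: the sum of `f` over each orbit is `c` times
the orbit size. -/
def IsMesic {X : Type*} (ρ : X → X) (f : X → ℝ) (c : ℝ) : Prop :=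
  ∀ x : X, ∑ᶠ y ∈ orbit ρ x, f y = (orbit ρ x).ncard * c


theorem m_mono (α : ℕ → ℕ) : Monotone (m α) :=
  monotone_nat_of_le_succ fun i => by simp [m, Finset.sum_range_succ]

theorem m_uniq {α : ℕ → ℕ} {i i' x : ℕ} (h1 : m α i ≤ x) (h2 : x < m α (i + 1))
    (h3 : m α i' ≤ x) (h4 : x < m α (i' + 1)) : i = i' := by
  rcases lt_trichotomy i i' with h | h | h
  · have := m_mono α (show i + 1 ≤ i' from h)
    omega
  · exact h
  · have := m_mono α (show i' + 1 ≤ i from h)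
    omega

theorem minOut_iff {t : ℕ} {α : ℕ → ℕ} (I : J t α) {p : V t α} (hp : Elem t α p) :
    MinOut t α I.1 p ↔ p ∉ I.1 ∧ ∀ q, Cov t α q p → q ∈ I.1 := by
  constructor
  · rintro ⟨_, h2, h3⟩
    refine ⟨h2, fun q hq => ?_⟩
    by_contra hqI
    have := h3 q (cov_elem hq).1 hqI (Relation.ReflTransGen.single hq)
    subst this
    obtain ⟨i, hi, hd, _⟩ := hq
    omega
  · rintro ⟨h2, h3⟩
    refine ⟨hp, h2, fun q _ hqI hle => ?_⟩
    rcases Relation.ReflTransGen.cases_tail hle with h | ⟨r, hr, hrp⟩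
    · exact h.symm
    · exact absurd (I.2.2 q r hr (h3 r hrp)) hqI

theorem maxIn_iff {t : ℕ} {α : ℕ → ℕ} (I : J t α) {p : V t α} :
    MaxIn t α I.1 p ↔ p ∈ I.1 ∧ ∀ q, Cov t α p q → q ∉ I.1 := by
  constructor
  · rintro ⟨h2, h3⟩
    refine ⟨h2, fun q hq hqI => ?_⟩
    have := h3 q hqI (Relation.ReflTransGen.single hq)
    subst this
    obtain ⟨i, hi, hd, _⟩ := hq
    omega
  · rintro ⟨h2, h3⟩
    refine ⟨h2, fun q hqI hle => ?_⟩
    rcases Relation.ReflTransGen.cases_head hle with h | ⟨r, hpr, hr⟩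
    · exact h.symm
    · exact absurd (I.2.2 r q hr hqI) (h3 r hpr)

theorem Tg_eq {t : ℕ} {α : ℕ → ℕ} {p : V t α} (hp : Elem t α p) (L U : J t α → ℝ)
    (hL : ∀ I : J t α, L I = if ∀ q, Cov t α q p → q ∈ I.1 then 1 else 0)
    (hU : ∀ I : J t α, U I = if ∀ q, Cov t α p q → q ∉ I.1 then 0 else 1) :
    L - (2 : ℝ) • chiHat t α p + U ∈ ToggSpan t α := by
  apply Submodule.subset_span
  refine ⟨p, hp, ?_⟩
  funext I
  simp only [Pi.add_apply, Pi.sub_apply, Pi.smul_apply, smul_eq_mul, hL, hU, chiHat, Tg,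
    minOut_iff I hp, maxIn_iff I]
  by_cases h : p ∈ I.1
  · have h1 : ∀ q, Cov t α q p → q ∈ I.1 := fun q hq =>
      I.2.2 q p (Relation.ReflTransGen.single hq) h
    by_cases h2 : ∀ q, Cov t α p q → q ∉ I.1
    · rw [if_pos h1, if_pos h2, if_pos h, if_neg (fun hh => hh.1 h), if_pos ⟨h, h2⟩]; norm_num
    · rw [if_pos h1, if_neg h2, if_pos h, if_neg (fun hh => hh.1 h), if_neg (fun hh => h2 hh.2)]
      norm_num
  · have h1 : ∀ q, Cov t α p q → q ∉ I.1 := fun q hq hqI =>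
      h (I.2.2 p q (Relation.ReflTransGen.single hq) hqI)
    rw [if_pos h1]
    simp [h]

theorem low_one {t : ℕ} {α : ℕ → ℕ} {p d : V t α} (h : ∀ q, Cov t α q p ↔ q = d)
    (I : J t α) : chiHat t α d I = if ∀ q, Cov t α q p → q ∈ I.1 then 1 else 0 := by
  simp [h, chiHat]

theorem low_none {t : ℕ} {α : ℕ → ℕ} {p : V t α} (h : ∀ q, ¬ Cov t α q p)
    (I : J t α) : (1 : J t α → ℝ) I = if ∀ q, Cov t α q p → q ∈ I.1 then 1 else 0 := by
  simp [h]

theorem up_one {t : ℕ} {α : ℕ → ℕ} {p d : V t α} (h : ∀ q, Cov t α p q ↔ q = d)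
    (I : J t α) : chiHat t α d I = if ∀ q, Cov t α p q → q ∉ I.1 then 0 else 1 := by
  simp only [h, chiHat, forall_eq]
  split_ifs <;> simp_all

theorem up_none {t : ℕ} {α : ℕ → ℕ} {p : V t α} (h : ∀ q, ¬ Cov t α p q)
    (I : J t α) : (0 : J t α → ℝ) I = if ∀ q, Cov t α p q → q ∉ I.1 then 0 else 1 := by
  simp [h]

theorem cov_even {t : ℕ} {α : ℕ → ℕ} {i : ℕ} (hi : i < t) (he : i % 2 = 0) {p : V t α}
    (h1 : m α i < p) (h2 : (p : ℕ) < m α (i + 1)) (q : V t α) :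
    (Cov t α q p ↔ ((q : ℕ) + 1 = p ∧ 1 ≤ (q : ℕ))) ∧ (Cov t α p q ↔ (q : ℕ) = p + 1) := by
  have hq := q.2
  have hp := p.2
  refine ⟨⟨?_, ?_⟩, ⟨?_, ?_⟩⟩
  · rintro ⟨i', h, hd, ha, hb, hc, hd'⟩
    rcases hd with ⟨_, hd⟩ | ⟨ho, hd⟩
    · omega
    · have := m_uniq (i := i) (i' := i') (α := α) (x := p) (by omega) h2 (by omega) (by omega)
      omega
  · rintro ⟨h, h'⟩
    exact ⟨i, hi, Or.inl ⟨he, by omega⟩, by omega, by omega, by omega, by omega⟩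
  · rintro ⟨i', h, hd, ha, hb, hc, hd'⟩
    rcases hd with ⟨_, hd⟩ | ⟨ho, hd⟩
    · omega
    · have := m_uniq (i := i) (i' := i') (α := α) (x := q) (by omega) (by omega) (by omega)
        (by omega)
      omega
  · intro h
    exact ⟨i, hi, Or.inl ⟨he, by omega⟩, by omega, by omega, by omega, by omega⟩

theorem cov_odd {t : ℕ} {α : ℕ → ℕ} {i : ℕ} (hi : i < t) (he : i % 2 = 1) {p : V t α}
    (h1 : m α i < p) (h2 : (p : ℕ) < m α (i + 1)) (q : V t α) :
    (Cov t α p q ↔ ((q : ℕ) + 1 = p ∧ 1 ≤ (q : ℕ))) ∧ (Cov t α q p ↔ (q : ℕ) = p + 1) := by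
  have hq := q.2
  have hp := p.2
  refine ⟨⟨?_, ?_⟩, ⟨?_, ?_⟩⟩
  · rintro ⟨i', h, hd, ha, hb, hc, hd'⟩
    rcases hd with ⟨ho, hd⟩ | ⟨_, hd⟩
    · have := m_uniq (i := i) (i' := i') (α := α) (x := p) (by omega) h2 (by omega) (by omega)
      omega
    · omega
  · rintro ⟨h, h'⟩
    exact ⟨i, hi, Or.inr ⟨he, by omega⟩, by omega, by omega, by omega, by omega⟩
  · rintro ⟨i', h, hd, ha, hb, hc, hd'⟩
    rcases hd with ⟨ho, hd⟩ | ⟨_, hd⟩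
    · have := m_uniq (i := i) (i' := i') (α := α) (x := q) (by omega) (by omega) (by omega)
        (by omega)
      omega
    · omega
  · intro h
    exact ⟨i, hi, Or.inr ⟨he, by omega⟩, by omega, by omega, by omega, by omega⟩

theorem xel_val {t : ℕ} {α : ℕ → ℕ} {v : ℕ} (h : v ≤ nn t α) : (xel t α v : ℕ) = v :=
  Nat.mod_eq_of_lt (by omega)

theorem eq_xel {t : ℕ} {α : ℕ → ℕ} {v : ℕ} (h : v ≤ nn t α) (q : V t α) :
    q = xel t α v ↔ (q : ℕ) = v := by
  rw [Fin.ext_iff, xel_val h]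

/-- a sequence with second differences in `S` is affine modulo `S`. -/
theorem affine_mod {M : Type*} [AddCommGroup M] [Module ℝ M] (S : Submodule ℝ M)
    (f : ℕ → M) (N : ℕ)
    (h : ∀ a, 1 ≤ a → a < N → f (a - 1) - (2 : ℝ) • f a + f (a + 1) ∈ S)
    (j k : ℕ) (hj : j ≤ N) (hk : k ≤ N) :
    (k : ℝ) • f j - (j : ℝ) • f k - ((k : ℝ) - j) • f 0 ∈ S := by
  have key : ∀ a, (a ≤ N → f a - f 0 - (a : ℝ) • (f 1 - f 0) ∈ S) ∧
      (a + 1 ≤ N → f (a + 1) - f 0 - ((a + 1 : ℕ) : ℝ) • (f 1 - f 0) ∈ S) := by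
    intro a
    induction a with
    | zero => simp
    | succ a ih =>
      refine ⟨ih.2, fun ha => ?_⟩
      have h1 := ih.1 (by omega)
      have h2 := ih.2 (by omega)
      have h3 := h (a + 1) (by omega) (by omega)
      have := S.add_mem (S.sub_mem (S.smul_mem 2 h2) h1) h3
      convert this using 1
      simp only [Nat.add_sub_cancel]
      push_cast
      module
  have := S.sub_mem (S.smul_mem (k : ℝ) ((key j).1 hj)) (S.smul_mem (j : ℝ) ((key k).1 hk))
  convert this using 1
  module

/-- Corollary `oi homomesies cor`.
(1) If `S_i` has no valley, then `k·χ̂_{(i,j)} − j·χ̂_{(i,k)} ≡ k − j`.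
(2) If `S_i` has no peak, then `(α_i−k)·χ̂_{(i,j)} − (α_i−j)·χ̂_{(i,k)} ≡ 0`. -/
theorem statement6 (t : ℕ) (α : ℕ → ℕ) (hF : IsFence t α)
    (i : ℕ) (hi1 : 1 ≤ i) (hit : i ≤ t)
    (j k : ℕ) (hj1 : 1 ≤ j) (hj2 : j ≤ α (i - 1) - 1) (hk1 : 1 ≤ k)
    (hk2 : k ≤ α (i - 1) - 1) :
    (¬ HasValley t i →
      Equiv' t α
        (fun I => (k : ℝ) * chiHat t α (uElx t α i j) I
          - (j : ℝ) * chiHat t α (uElx t α i k) I)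
        (fun _ => (k : ℝ) - (j : ℝ)))
    ∧ (¬ HasPeak t i →
      Equiv' t α
        (fun I => ((α (i - 1) : ℝ) - (k : ℝ)) * chiHat t α (uElx t α i j) I
          - ((α (i - 1) : ℝ) - (j : ℝ)) * chiHat t α (uElx t α i k) I)
        (fun _ => (0 : ℝ))) := by
  obtain ⟨ht, hpos, h0, hl⟩ := hF
  obtain ⟨r, rfl⟩ : ∃ r, i = r + 1 := ⟨i - 1, by omega⟩
  simp only [Nat.add_sub_cancel] at *
  have hm : m α (r + 1) = m α r + α r := by simp [m, Finset.sum_range_succ]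
  have hmt : m α (r + 1) ≤ m α t := m_mono α hit
  constructor
  · intro hV
    have := affine_mod (ToggSpan t α)
      (fun a => if a = 0 then 1 else chiHat t α (uElx t α (r + 1) a)) (α r - 1) ?_ j k hj2 hk2
    · unfold Equiv'
      convert this using 1
      funext I
      simp [show j ≠ 0 by omega, show k ≠ 0 by omega]
    · intro a ha1 ha2
      simp only [show a ≠ 0 by omega, if_false, Nat.add_eq_zero_iff, one_ne_zero, and_false]
      by_cases he : r % 2 = 0
      · have hr : r = 0 := by
          simp only [HasValley] at hV; omega
        subst hr
        have hm0 : m α 0 = 0 := by simp [m]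
        simp only [uElx, uEl, Nat.add_sub_cancel, Nat.zero_mod, if_true, hm0, zero_add]
        have hnn : a + 1 ≤ nn t α := by unfold nn; omega
        have hv : (xel t α a : ℕ) = a := xel_val (by omega)
        have hc := cov_even (t := t) (α := α) (i := 0) (p := xel t α a) (by omega) rfl
          (by omega) (by omega)
        refine Tg_eq (by unfold Elem; omega) _ _ ?_ (up_one fun q => ?_)
        · split_ifs with h
          · refine low_none fun q => ?_
            rw [(hc q).1]; omega
          · refine low_one fun q => ?_
            rw [(hc q).1, eq_xel (by omega)]; omega
        · rw [(hc q).2, eq_xel (by omega)]; omega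
      · have hr : t = r + 1 := by
          simp only [HasValley] at hV; omega
        have hn : nn t α = m α (r + 1) - 1 := by unfold nn; rw [hr]
        simp only [uElx, uEl, Nat.add_sub_cancel, if_neg he]
        have hv : (xel t α (m α (r + 1) - a) : ℕ) = m α (r + 1) - a := xel_val (by omega)
        have hc := cov_odd (t := t) (α := α) (i := r) (p := xel t α (m α (r + 1) - a)) (by omega)
          (by omega) (by omega) (by omega)
        refine Tg_eq (by unfold Elem; omega) _ _ ?_ (up_one fun q => ?_)
        · split_ifs with h
          · refine low_none fun q => ?_
            have := q.2
            rw [(hc q).2]; omega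
          · refine low_one fun q => ?_
            rw [(hc q).2, eq_xel (by omega)]; omega
        · rw [(hc q).1, eq_xel (by omega)]; omega
  · intro hP
    simp only [HasPeak] at hP
    have hr : t = r + 1 := by omega
    have he : r % 2 = 0 := by omega
    have hn : nn t α = m α (r + 1) - 1 := by unfold nn; rw [hr]
    have := affine_mod (ToggSpan t α)
      (fun a => if a = 0 then 0 else chiHat t α (uElx t α (r + 1) (α r - a))) (α r - 1) ?_
      (α r - j) (α r - k) (by omega) (by omega)
    · unfold Equiv'
      convert this using 1
      have e1 : α r - (α r - j) = j := by omega
      have e2 : α r - (α r - k) = k := by omega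
      funext I
      simp only [show α r - j ≠ 0 by omega, show α r - k ≠ 0 by omega, e1, e2, if_false]
      rw [Nat.cast_sub (by omega), Nat.cast_sub (by omega)]
      simp
    · intro a ha1 ha2
      simp only [show a ≠ 0 by omega, if_false, Nat.add_eq_zero_iff, one_ne_zero, and_false]
      simp only [uElx, uEl, Nat.add_sub_cancel, if_pos he]
      have hv : (xel t α (m α r + (α r - a)) : ℕ) = m α r + (α r - a) := xel_val (by omega)
      have hc := cov_even (t := t) (α := α) (i := r) (p := xel t α (m α r + (α r - a)))
        (by omega) he (by omega) (by omega)
      rw [add_comm, add_sub, add_sub_right_comm]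
      refine Tg_eq (by unfold Elem; omega) _ _ (low_one fun q => ?_) ?_
      · rw [(hc q).1, eq_xel (by omega)]; omega
      · split_ifs with h
        · refine up_none fun q => ?_
          have := q.2
          rw [(hc q).2]; omega
        · refine up_one fun q => ?_
          rw [(hc q).2, eq_xel (by omega)]; omega

end Fence
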